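/- Let n ≥ 1, 0 < α < n, 1 < p < n/α, and let q be defined by 1/p − 1/q = α/n, and let w be a weight on ℝⁿ. Suppose there exists a constant C > 0 such that ‖w·M_α f‖_{L^{q,∞}} ≤ C·‖f‖_{L^p(w^p)} for every f ∈ L^p(w^p). If there exists a cube Q with ∫_Q w^{−p'} dx = ∞ (where p' = p/(p−1)), then w = 0 almost everywhere on ℝⁿ. -/

import Mathlib

open MeasureTheory Set
open scoped ENNReal

noncomputable section

/-- An axis-parallel cube in `ℝⁿ` (realized as `Fin n → ℝ`) with positive finite side length. -/
def IsCube (n : ℕ) (Q : Set (Fin n → ℝ)) : Prop :=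
  ∃ (a : Fin n → ℝ) (h : ℝ), 0 < h ∧ Q = Set.univ.pi fun i => Set.Icc (a i) (a i + h)

/-- The weak `L^p` quasinorm `sup_{t>0} t · |{x : g x > t}|^{1/p}` of an `ℝ≥0∞`-valued
function on `ℝⁿ`. -/
def wnormE (n : ℕ) (p : ℝ) (g : (Fin n → ℝ) → ℝ≥0∞) : ℝ≥0∞ :=
  ⨆ (t : ℝ) (_ : 0 < t), ENNReal.ofReal t * volume {x | ENNReal.ofReal t < g x} ^ (1 / p)

/-- The Hardy–Littlewood maximal operator: supremum of averages of `|f|` over cubes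
containing `x`. -/
def maximalFn (n : ℕ) (f : (Fin n → ℝ) → ℝ) (x : Fin n → ℝ) : ℝ≥0∞ :=
  ⨆ (Q : Set (Fin n → ℝ)) (_ : IsCube n Q) (_ : x ∈ Q),
    (volume Q)⁻¹ * ∫⁻ y in Q, ENNReal.ofReal |f y|

/-- The fractional maximal operator `M_α`. -/
def fracMaximalFn (n : ℕ) (α : ℝ) (f : (Fin n → ℝ) → ℝ) (x : Fin n → ℝ) : ℝ≥0∞ :=
  ⨆ (Q : Set (Fin n → ℝ)) (_ : IsCube n Q) (_ : x ∈ Q),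
    volume Q ^ (α / (n : ℝ)) * ((volume Q)⁻¹ * ∫⁻ y in Q, ENNReal.ofReal |f y|)

/-- The multiplier `A_p^*` characteristic
`[w]_{A_p^*} = sup_Q (|Q|⁻¹·‖w·χ_Q‖_{L^{1,∞}})·(⨍_Q w^{1-p'})^{p-1}`, with `p' = p/(p-1)`. -/
def ApStarConst (n : ℕ) (p : ℝ) (w : (Fin n → ℝ) → ℝ) : ℝ≥0∞ :=
  ⨆ (Q : Set (Fin n → ℝ)) (_ : IsCube n Q),
    (volume Q)⁻¹ * wnormE n 1 (Q.indicator fun x => ENNReal.ofReal (w x)) *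
      ((volume Q)⁻¹ * ∫⁻ x in Q, ENNReal.ofReal (w x ^ (1 - p / (p - 1)))) ^ (p - 1)

/-- The multiplier `A_{p,q}^*` characteristic
`[w]_{A_{p,q}^*} = sup_Q (|Q|⁻¹·‖w^q·χ_Q‖_{L^{1,∞}})^{1/q}·(⨍_Q w^{-p'})^{1/p'}`,
with `p' = p/(p-1)` and `1/p' = 1 - 1/p`. -/
def ApqStarConst (n : ℕ) (p q : ℝ) (w : (Fin n → ℝ) → ℝ) : ℝ≥0∞ :=
  ⨆ (Q : Set (Fin n → ℝ)) (_ : IsCube n Q),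
    ((volume Q)⁻¹ * wnormE n 1 (Q.indicator fun x => ENNReal.ofReal (w x ^ q))) ^ (1 / q) *
      ((volume Q)⁻¹ * ∫⁻ x in Q, ENNReal.ofReal (w x ^ (-(p / (p - 1))))) ^ (1 - 1 / p)

/-- The Muckenhoupt `A_p` characteristic `[w]_{A_p} = sup_Q (⨍_Q w)·(⨍_Q w^{1-p'})^{p-1}`. -/
def ApConst (n : ℕ) (p : ℝ) (w : (Fin n → ℝ) → ℝ) : ℝ≥0∞ :=
  ⨆ (Q : Set (Fin n → ℝ)) (_ : IsCube n Q),
    ((volume Q)⁻¹ * ∫⁻ x in Q, ENNReal.ofReal (w x)) *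
      ((volume Q)⁻¹ * ∫⁻ x in Q, ENNReal.ofReal (w x ^ (1 - p / (p - 1)))) ^ (p - 1)

/-- The Muckenhoupt `A_{p,q}` characteristic
`[w]_{A_{p,q}} = sup_Q (⨍_Q w^q)^{1/q}·(⨍_Q w^{-p'})^{1/p'}`. -/
def ApqConst (n : ℕ) (p q : ℝ) (w : (Fin n → ℝ) → ℝ) : ℝ≥0∞ :=
  ⨆ (Q : Set (Fin n → ℝ)) (_ : IsCube n Q),
    ((volume Q)⁻¹ * ∫⁻ x in Q, ENNReal.ofReal (w x ^ q)) ^ (1 / q) *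
      ((volume Q)⁻¹ * ∫⁻ x in Q, ENNReal.ofReal (w x ^ (-(p / (p - 1))))) ^ (1 - 1 / p)

lemma rpow_ne_zero_aux {x : ℝ≥0∞} {y : ℝ} (hx : 0 < x) (hx' : x ≠ ∞) : x ^ y ≠ 0 :=
  (ENNReal.rpow_pos hx hx').ne'

lemma cube_volume {n : ℕ} {R : Set (Fin n → ℝ)} (hR : IsCube n R) :
    volume R ≠ 0 ∧ volume R ≠ ∞ ∧ MeasurableSet R := by
  obtain ⟨a, h, hh, rfl⟩ := hR
  refine ⟨?_, ?_, ?_⟩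
  · rw [volume_pi, Measure.pi_pi]
    simp [hh, Finset.prod_eq_zero_iff]
  · exact (isCompact_univ_pi fun i => isCompact_Icc).measure_lt_top.ne
  · exact MeasurableSet.univ_pi fun i => measurableSet_Icc

/-- Suppose the multiplier weak-type inequality
`‖w·M_α f‖_{L^{q,∞}} ≤ C·‖f‖_{L^p(w^p)}` holds for all `f ∈ L^p(w^p)`. If there is a cube `Q`
with `∫_Q w^{-p'} = ∞`, then `w = 0` almost everywhere. -/
theorem statement14 (n : ℕ) (hn : 1 ≤ n) (α : ℝ) (hα : 0 < α) (hαn : α < (n : ℝ))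
    (p : ℝ) (hp : 1 < p) (hpn : p < (n : ℝ) / α) (q : ℝ)
    (hq : 1 / p - 1 / q = α / (n : ℝ))
    (w : (Fin n → ℝ) → ℝ) (hwm : Measurable w) (hw0 : ∀ x, 0 ≤ w x)
    (C : ℝ) (hC : 0 < C)
    (hbound : ∀ f : (Fin n → ℝ) → ℝ, Measurable f →
        (∫⁻ x, ENNReal.ofReal (|f x| ^ p * w x ^ p)) < ∞ →
        wnormE n q (fun x => ENNReal.ofReal (w x) * fracMaximalFn n α f x) ≤
          ENNReal.ofReal C * (∫⁻ x, ENNReal.ofReal (|f x| ^ p * w x ^ p)) ^ (1 / p))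
    (Q : Set (Fin n → ℝ)) (hQ : IsCube n Q)
    (hσ : (∫⁻ x in Q, ENNReal.ofReal (w x ^ (-(p / (p - 1))))) = ∞) :
    ∀ᵐ x ∂(volume : Measure (Fin n → ℝ)), w x = 0 := by
  have hp0 : 0 < p := by linarith
  have hn0 : (0 : ℝ) < n := by exact_mod_cast hn
  have hq0 : 0 < 1 / q := by
    have h1 : α / n < 1 / p := by
      rw [div_lt_div_iff₀ hn0 hp0]
      rw [lt_div_iff₀ hα] at hpn
      linarith
    linarith
  have hr0 : 0 < 1 - 1 / p := by
    have : 1 / p < 1 := by rw [div_lt_one hp0]; exact hp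
    linarith
  have hp' : 0 < p / (p - 1) := div_pos hp0 (by linarith)
  obtain ⟨hQ0, hQt, hQm⟩ := cube_volume hQ
  set r := p / (p - 1) with hr
  set E : ℕ → Set (Fin n → ℝ) := fun k => Q ∩ {x | 1 / ((k : ℝ) + 1) < w x} with hE
  have hEm : ∀ k, MeasurableSet (E k) := fun k => hQm.inter (measurableSet_lt measurable_const hwm)
  have hEw : ∀ k x, x ∈ E k → 0 < w x := fun k x hx => lt_trans (by positivity) hx.2
  set S : ℕ → ℝ≥0∞ := fun k => ∫⁻ x in E k, ENNReal.ofReal (w x ^ (-r)) with hS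
  have hSt : ∀ k, S k ≠ ∞ := by
    intro k
    have h1 : S k ≤ ∫⁻ x in E k, ENNReal.ofReal ((1 / ((k : ℝ) + 1)) ^ (-r)) := by
      refine setLIntegral_mono' (hEm k) fun x hx => ENNReal.ofReal_le_ofReal ?_
      exact Real.rpow_le_rpow_of_nonpos (by positivity) (le_of_lt hx.2) (by linarith)
    refine ne_top_of_le_ne_top ?_ h1
    rw [setLIntegral_const]
    exact ENNReal.mul_ne_top ENNReal.ofReal_ne_top
      (ne_top_of_le_ne_top hQt (measure_mono inter_subset_left))
  have hSsup : ⨆ k, S k = ∞ := by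
    have hmono : Monotone E := by
      intro i j hij x hx
      refine ⟨hx.1, lt_of_le_of_lt (b := 1 / ((i : ℝ) + 1)) ?_ hx.2⟩
      exact Nat.one_div_le_one_div hij
    have h1 : ∫⁻ x in ⋃ k, E k, ENNReal.ofReal (w x ^ (-r)) = ⨆ k, S k :=
      setLIntegral_iUnion_of_directed _ hmono.directed_le
    rw [← h1, eq_top_iff, ← hσ, ← lintegral_indicator hQm,
      ← lintegral_indicator (MeasurableSet.iUnion hEm)]
    refine lintegral_mono fun x => ?_
    by_cases hxQ : x ∈ Q
    · by_cases hxw : w x = 0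
      · simp [hxQ, hxw, Real.zero_rpow (neg_ne_zero.mpr hp'.ne')]
      · have : x ∈ ⋃ k, E k := by
          obtain ⟨k, hk⟩ := exists_nat_one_div_lt (lt_of_le_of_ne (hw0 x) (Ne.symm hxw))
          exact mem_iUnion.2 ⟨k, hxQ, hk⟩
        rw [indicator_of_mem hxQ, indicator_of_mem this]
    · rw [indicator_of_notMem hxQ]; exact zero_le
  have key : ∀ R : Set (Fin n → ℝ), IsCube n R → Q ⊆ R → ∀ s : ℝ, 0 < s →
      volume (R ∩ {x | s < w x}) = 0 := by
    intro R hR hQR s hs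
    obtain ⟨hR0, hRt, hRm⟩ := cube_volume hR
    set A := R ∩ {x | s < w x} with hA
    set c := volume R ^ (α / (n : ℝ)) * (volume R)⁻¹ with hc
    have hc0 : c ≠ 0 := mul_ne_zero (rpow_ne_zero_aux
      (pos_iff_ne_zero.2 hR0) hRt) (ENNReal.inv_ne_zero.2 hRt)
    have hct : c ≠ ∞ := ENNReal.mul_ne_top
      (ENNReal.rpow_ne_top_of_nonneg (by positivity) hRt) (ENNReal.inv_ne_top.2 hR0)
    by_contra hA0
    set D := ENNReal.ofReal s * c * volume A ^ (1 / q) with hD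
    have hAt : volume A ≠ ∞ := ne_top_of_le_ne_top hRt (measure_mono inter_subset_left)
    have hD0 : D ≠ 0 := by
      refine mul_ne_zero (mul_ne_zero ?_ hc0)
        (rpow_ne_zero_aux (pos_iff_ne_zero.2 hA0) hAt)
      simpa using hs
    have hDt : D ≠ ∞ := ENNReal.mul_ne_top (ENNReal.mul_ne_top ENNReal.ofReal_ne_top hct)
      (ENNReal.rpow_ne_top_of_nonneg hq0.le hAt)
    have main : ∀ k, D * S k ^ (1 - 1 / p) ≤ ENNReal.ofReal C := by
      intro k
      by_cases hS0 : S k = 0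
      · rw [hS0, ENNReal.zero_rpow_of_pos hr0]; simp
      set f : (Fin n → ℝ) → ℝ := (E k).indicator fun x => w x ^ (-r) with hf
      have hfm : Measurable f := (hwm.pow_const _).indicator (hEm k)
      have hfint : (∫⁻ x, ENNReal.ofReal (|f x| ^ p * w x ^ p)) = S k := by
        rw [hS]
        dsimp only
        rw [← lintegral_indicator (hEm k)]
        refine lintegral_congr fun x => ?_
        by_cases hx : x ∈ E k
        · have hw := hEw k x hx
          rw [hf, indicator_of_mem hx, indicator_of_mem hx, abs_of_pos (Real.rpow_pos_of_pos hw _),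
            ← Real.rpow_mul hw.le, ← Real.rpow_add hw]
          congr 2
          have : p - 1 ≠ 0 := by linarith
          rw [hr]; field_simp; ring
        · rw [hf, indicator_of_notMem hx, indicator_of_notMem hx]
          simp [Real.zero_rpow hp0.ne']
      have hb := hbound f hfm (by rw [hfint]; exact (hSt k).lt_top)
      rw [hfint] at hb
      have hcS0 : c * S k ≠ 0 := mul_ne_zero hc0 hS0
      have hcSt : c * S k ≠ ∞ := ENNReal.mul_ne_top hct (hSt k)
      have hM : ∀ x ∈ R, c * S k ≤ fracMaximalFn n α f x := by
        intro x hx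
        have h1 : S k ≤ ∫⁻ y in R, ENNReal.ofReal |f y| := by
          rw [hS]
          dsimp only
          calc _ = ∫⁻ y in E k, ENNReal.ofReal |f y| := by
                refine setLIntegral_congr_fun (hEm k) fun y hy => ?_
                simp only [hf, indicator_of_mem hy,
                  abs_of_pos (Real.rpow_pos_of_pos (hEw k y hy) _)]
            _ ≤ _ := lintegral_mono_set (inter_subset_left.trans hQR)
        calc c * S k ≤ c * ∫⁻ y in R, ENNReal.ofReal |f y| := by gcongr
          _ = volume R ^ (α / (n : ℝ)) * ((volume R)⁻¹ * ∫⁻ y in R, ENNReal.ofReal |f y|) := by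
              rw [hc, mul_assoc]
          _ ≤ _ := by
              unfold fracMaximalFn
              exact le_iSup_of_le R (le_iSup_of_le hR (le_iSup_of_le hx le_rfl))
      have ht : 0 < s * (c * S k).toReal := mul_pos hs (ENNReal.toReal_pos hcS0 hcSt)
      have hte : ENNReal.ofReal (s * (c * S k).toReal) = ENNReal.ofReal s * (c * S k) := by
        rw [ENNReal.ofReal_mul hs.le, ENNReal.ofReal_toReal hcSt]
      have h2 : ENNReal.ofReal s * (c * S k) * volume A ^ (1 / q) ≤
          ENNReal.ofReal C * S k ^ (1 / p) := by
        refine le_trans ?_ hb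
        unfold wnormE
        refine le_iSup_of_le (s * (c * S k).toReal) (le_iSup_of_le ht ?_)
        rw [hte]
        gcongr
        intro x hx
        have h3 : ENNReal.ofReal s < ENNReal.ofReal (w x) :=
          (ENNReal.ofReal_lt_ofReal_iff (hs.trans hx.2)).2 hx.2
        calc ENNReal.ofReal s * (c * S k) < ENNReal.ofReal (w x) * (c * S k) :=
              (ENNReal.mul_lt_mul_iff_left hcS0 hcSt).2 h3
          _ ≤ _ := mul_le_mul_right (hM x hx.1) _
      have hsp : S k = S k ^ (1 - 1 / p) * S k ^ (1 / p) := by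
        rw [← ENNReal.rpow_add _ _ hS0 (hSt k)]; simp
      have hSp0 : S k ^ (1 / p) ≠ 0 :=
        rpow_ne_zero_aux (pos_iff_ne_zero.2 hS0) (hSt k)
      have hSpt : S k ^ (1 / p) ≠ ∞ := ENNReal.rpow_ne_top_of_nonneg (by positivity) (hSt k)
      rw [← ENNReal.mul_le_mul_iff_left hSp0 hSpt]
      calc D * S k ^ (1 - 1 / p) * S k ^ (1 / p) = D * S k := by rw [mul_assoc, ← hsp]
        _ = ENNReal.ofReal s * (c * S k) * volume A ^ (1 / q) := by rw [hD]; ring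
        _ ≤ _ := h2
    have hle : ⨆ k, S k ≤ (ENNReal.ofReal C / D) ^ (1 / (1 - 1 / p)) := by
      refine iSup_le fun k => ?_
      have h4 : S k ^ (1 - 1 / p) ≤ ENNReal.ofReal C / D := by
        rw [ENNReal.le_div_iff_mul_le (Or.inl hD0) (Or.inl hDt), mul_comm]
        exact main k
      rw [one_div, ENNReal.le_rpow_inv_iff hr0]
      exact h4
    rw [hSsup, top_le_iff] at hle
    exact ENNReal.rpow_ne_top_of_nonneg (by positivity)
      (ENNReal.div_ne_top ENNReal.ofReal_ne_top hD0) hle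
  obtain ⟨a, h, hh, hQe⟩ := hQ
  rw [ae_iff]
  refine measure_mono_null (t := ⋃ m : ℕ, ⋃ k : ℕ,
    (univ.pi fun i => Icc (a i - m) (a i - m + (h + 2 * m))) ∩ {x | 1 / ((k : ℝ) + 1) < w x})
    ?_ ?_
  · intro x hx
    obtain ⟨k, hk⟩ := exists_nat_one_div_lt (lt_of_le_of_ne (hw0 x) (Ne.symm hx))
    obtain ⟨m, hm⟩ := exists_nat_ge ‖x - a‖
    refine mem_iUnion.2 ⟨m, mem_iUnion.2 ⟨k, ?_, hk⟩⟩
    intro i _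
    have h5 : |x i - a i| ≤ m := (norm_le_pi_norm (x - a) i).trans hm
    rw [abs_le] at h5
    constructor <;> linarith
  · refine measure_iUnion_null fun m => measure_iUnion_null fun k => ?_
    have hm : (0 : ℝ) ≤ m := Nat.cast_nonneg m
    refine key _ ⟨fun i => a i - m, h + 2 * m, by positivity, rfl⟩ ?_ _ (by positivity)
    rw [hQe]
    refine pi_mono fun i _ => Icc_subset_Icc ?_ ?_ <;> linarith
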